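/- Let G be a unicyclic graph on n ≥ 8 vertices. Then μ_α(G) ≥ μ_α(S_n⁺), with equality if and only if G ≅ S_n⁺, where S_n⁺ is the star S_n with one extra edge between two leaves. -/

import Mathlib

open Finset Matrix

namespace DistAlpha

variable {V : Type*} [Fintype V] [DecidableEq V]

/-- The distance matrix of a graph, with real entries. -/
noncomputable def distMatrix (G : SimpleGraph V) : Matrix V V ℝ :=
  fun u v => (G.dist u v : ℝ)

/-- The transmission of a vertex: the sum of distances to all vertices. -/
noncomputable def transmission (G : SimpleGraph V) (u : V) : ℝ :=
  ∑ v, (G.dist u v : ℝ)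

/-- The matrix `D_α = α T + (1-α) D`. -/
noncomputable def Dalpha (G : SimpleGraph V) (α : ℝ) : Matrix V V ℝ :=
  α • Matrix.diagonal (transmission G) + (1 - α) • distMatrix G

/-- The distance α-spectral radius: the largest (real) eigenvalue of `D_α`. -/
noncomputable def muAlpha (G : SimpleGraph V) (α : ℝ) : ℝ :=
  sSup (spectrum ℝ (Dalpha G α))

/-- The transmission of a graph: sum of distances over unordered pairs. -/
noncomputable def sigma (G : SimpleGraph V) : ℝ :=
  (∑ u, ∑ v, (G.dist u v : ℝ)) / 2

/-- A graph is transmission regular if all vertex transmissions are equal. -/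
def TransmissionRegular (G : SimpleGraph V) : Prop :=
  ∀ u v : V, transmission G u = transmission G v

/-- The graph `Sₙ⁺`: the star on `n` vertices (center `0`) with an extra edge joining the
leaves `1` and `2`. -/
def SnPlus (n : ℕ) : SimpleGraph (Fin n) :=
  SimpleGraph.fromRel (fun u v => u.val = 0 ∨ (u.val = 1 ∧ v.val = 2))

section Combinatorics

/-- Ordered pairs of distinct vertices that are neither adjacent nor have a common neighbor. -/
noncomputable def farPairs {W : Type*} [Fintype W] (G : SimpleGraph W) : Finset (W × W) :=
  open Classical in
  univ.filter fun p => p.1 ≠ p.2 ∧ ¬ G.Adj p.1 p.2 ∧ ∀ w, ¬ (G.Adj p.1 w ∧ G.Adj w p.2)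

lemma mem_farPairs {W : Type*} [Fintype W] {G : SimpleGraph W} {p : W × W} :
    p ∈ farPairs G ↔ p.1 ≠ p.2 ∧ ¬ G.Adj p.1 p.2 ∧ ∀ w, ¬ (G.Adj p.1 w ∧ G.Adj w p.2) := by
  simp [farPairs]

/-- A graph with as many edges as vertices and a dominating vertex is a star plus one edge. -/
lemma exists_adj_iff_of_dominating (G : SimpleGraph V) [DecidableRel G.Adj]
    (huni : G.edgeFinset.card = Fintype.card V) {c : V} (hc : ∀ x, x ≠ c → G.Adj c x) :
    ∃ a b, a ≠ c ∧ b ≠ c ∧ a ≠ b ∧ ∀ x y, G.Adj x y ↔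
      x ≠ y ∧ (x = c ∨ y = c ∨ (x = a ∧ y = b) ∨ (x = b ∧ y = a)) := by
  have hdeg : G.degree c + 1 = Fintype.card V := by
    have h : insert c (G.neighborFinset c) = univ := by
      ext x
      by_cases hx : x = c <;> simp [hx, hc]
    rw [← card_univ, ← h, card_insert_of_notMem (by simp),
      SimpleGraph.card_neighborFinset_eq_degree]
  have hcard : (G.edgeFinset \ G.incidenceFinset c).card = 1 := by
    rw [card_sdiff_of_subset (G.incidenceFinset_subset c),
      SimpleGraph.card_incidenceFinset_eq_degree]
    omega
  obtain ⟨e, he⟩ := card_eq_one.mp hcard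
  induction e using Sym2.ind with
  | _ a b =>
    have key : ∀ x y, (G.Adj x y ∧ x ≠ c ∧ y ≠ c) ↔ (x = a ∧ y = b) ∨ (x = b ∧ y = a) := by
      intro x y
      have h := Finset.ext_iff.mp he s(x, y)
      simp only [mem_sdiff, SimpleGraph.mem_edgeFinset, SimpleGraph.mem_edgeSet,
        SimpleGraph.mem_incidenceFinset, SimpleGraph.mk'_mem_incidenceSet_iff, mem_singleton,
        Sym2.eq_iff] at h
      rw [← h]
      grind
    have hab := (key a b).mpr (Or.inl ⟨rfl, rfl⟩)
    refine ⟨a, b, hab.2.1, hab.2.2, hab.1.ne, fun x y => ?_⟩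
    have := key x y
    have h1 := hc x
    have h2 := hc y
    have h3 : G.Adj x y → x ≠ y := fun h => h.ne
    have h4 := G.adj_comm x y
    grind

/-- The far pairs seen from a leaf are the non-neighbors of its support vertex. -/
lemma card_farPairs_leaf_le (G : SimpleGraph V) [DecidableRel G.Adj] {v w : V}
    (hvw : ∀ x, G.Adj v x ↔ x = w) :
    (farPairs (G.induce {v}ᶜ)).card + 2 * Fintype.card V ≤
      (farPairs G).card + 2 * (G.degree w + 1) := by
  have hadj : G.Adj v w := (hvw w).mpr rfl
  set B : Finset V := univ \ insert w (G.neighborFinset w) with hB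
  have hBcard : B.card + (G.degree w + 1) = Fintype.card V := by
    have h := card_sdiff_add_card_eq_card (subset_univ (insert w (G.neighborFinset w)))
    rwa [card_insert_of_notMem (by simp), SimpleGraph.card_neighborFinset_eq_degree,
      card_univ] at h
  set F := (farPairs (G.induce {v}ᶜ)).image fun p => ((p.1 : V), (p.2 : V)) with hF
  have hFcard : F.card = (farPairs (G.induce {v}ᶜ)).card :=
    card_image_of_injective _ fun p q h => by
      simp only [Prod.mk.injEq] at h
      exact Prod.ext (Subtype.ext h.1) (Subtype.ext h.2)
  have hvB : v ∉ B := by simp [hB, hadj.symm]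
  have hFv : ∀ p ∈ F, p.1 ≠ v ∧ p.2 ≠ v := by
    intro p hp
    obtain ⟨q, -, rfl⟩ := mem_image.mp hp
    exact ⟨q.1.2, q.2.2⟩
  have hsub : F ∪ ({v} ×ˢ B ∪ B ×ˢ {v}) ⊆ farPairs G := by
    have hvx : ∀ x ∈ B, v ≠ x ∧ ¬ G.Adj v x ∧ ∀ y, ¬ (G.Adj v y ∧ G.Adj y x) := by
      intro x hx
      refine ⟨fun h => hvB (h ▸ hx), ?_⟩
      simp only [hB, mem_sdiff, mem_univ, mem_insert, SimpleGraph.mem_neighborFinset, not_or,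
        true_and] at hx
      grind
    intro p hp
    simp only [mem_union, mem_product, mem_singleton] at hp
    rcases hp with hp | ⟨h1, h2⟩ | ⟨h1, h2⟩
    · obtain ⟨q, hq, rfl⟩ := mem_image.mp hp
      rw [mem_farPairs] at hq ⊢
      refine ⟨fun h => hq.1 (Subtype.ext h), fun h => hq.2.1 h, fun y hy => ?_⟩
      by_cases hyv : y = v
      · subst hyv
        exact hq.1 (Subtype.ext (((hvw _).mp hy.1.symm).trans ((hvw _).mp hy.2).symm))
      · exact hq.2.2 ⟨y, hyv⟩ hy
    · rw [mem_farPairs, h1]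
      exact hvx _ h2
    · rw [mem_farPairs, h2]
      obtain ⟨g1, g2, g3⟩ := hvx _ h1
      exact ⟨g1.symm, fun h => g2 h.symm, fun y hy => g3 y ⟨hy.2.symm, hy.1.symm⟩⟩
  have hle := card_le_card hsub
  rw [card_union_of_disjoint, card_union_of_disjoint, card_product, card_product,
    card_singleton] at hle
  · omega
  · rw [disjoint_left]
    rintro p hp hp'
    simp only [mem_product, mem_singleton] at hp hp'
    exact hvB (hp.1 ▸ hp'.1)
  · rw [disjoint_left]
    rintro p hp hp'
    simp only [mem_union, mem_product, mem_singleton] at hp'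
    have := hFv p hp
    tauto

lemma card_farPairs_of_two_regular (G : SimpleGraph V) [DecidableRel G.Adj]
    (hd : ∀ x, G.degree x = 2) :
    Fintype.card V * Fintype.card V ≤ (farPairs G).card + 5 * Fintype.card V := by
  set N : V → Finset V := fun x =>
    insert x (G.neighborFinset x ∪ (G.neighborFinset x).biUnion fun y =>
      (G.neighborFinset y).erase x)
  have hN : ∀ x, (N x).card ≤ 5 := by
    intro x
    have h1 : (N x).card ≤ _ :=
      card_insert_le x (G.neighborFinset x ∪ (G.neighborFinset x).biUnion fun y =>
      (G.neighborFinset y).erase x)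
    have h2 := card_union_le (G.neighborFinset x) ((G.neighborFinset x).biUnion fun y =>
      (G.neighborFinset y).erase x)
    have h3 : ((G.neighborFinset x).biUnion fun y => (G.neighborFinset y).erase x).card
        ≤ (G.neighborFinset x).card * 1 := by
      refine card_biUnion_le_card_mul _ _ _ fun y hy => ?_
      rw [card_erase_of_mem (by simpa [SimpleGraph.adj_comm] using hy),
        SimpleGraph.card_neighborFinset_eq_degree, hd]
    rw [SimpleGraph.card_neighborFinset_eq_degree, hd] at h2 h3
    omega
  have hsub : (univ : Finset (V × V)) ⊆
      farPairs G ∪ univ.biUnion fun x => {x} ×ˢ N x := by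
    rintro ⟨x, y⟩ -
    by_cases h : y ∈ N x
    · simp [h]
    · refine mem_union_left _ (mem_farPairs.mpr ?_)
      simp only [N, mem_insert, mem_union, mem_biUnion, SimpleGraph.mem_neighborFinset,
        mem_erase] at h
      grind
  have h1 := (card_le_card hsub).trans (card_union_le _ _)
  have h2 : (univ.biUnion fun x => {x} ×ˢ N x).card ≤ (univ : Finset V).card * 5 :=
    card_biUnion_le_card_mul _ _ _ fun x _ => by simpa using hN x
  rw [card_univ, Fintype.card_prod] at h1
  rw [card_univ] at h2
  omega

/-- A unicyclic graph without dominating vertex other than the 5-cycle has at least `2 (n - 4)`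
ordered far pairs. -/
lemma dominating_or_card_farPairs.{u} (n : ℕ) : ∀ (W : Type u) [Fintype W] [DecidableEq W]
    (G : SimpleGraph W) [DecidableRel G.Adj], Fintype.card W = n → G.Connected →
    G.edgeFinset.card = n →
    (∃ c, ∀ x, x ≠ c → G.Adj c x) ∨ (n = 5 ∧ ∀ x, G.degree x = 2) ∨
      2 * n ≤ (farPairs G).card + 8 := by
  induction n with
  | zero => intros; right; right; omega
  | succ n ih =>
    intro W _ _ G _ hW hconn huni
    by_cases hsmall : n + 1 ≤ 4
    · right; right; omega
    have : Nontrivial W := Fintype.one_lt_card_iff_nontrivial.mp (by omega)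
    have hsum := G.sum_degrees_eq_twice_card_edges
    have hpos : ∀ x, 0 < G.degree x := fun x => hconn.preconnected.degree_pos_of_nontrivial x
    by_cases hleaf : ∃ v, G.degree v = 1
    · obtain ⟨v, hv⟩ := hleaf
      obtain ⟨w, hw⟩ := card_eq_one.mp ((G.card_neighborFinset_eq_degree v).trans hv)
      have hvw : ∀ x, G.Adj v x ↔ x = w := fun x => by
        rw [← SimpleGraph.mem_neighborFinset, hw, mem_singleton]
      have hconn' := hconn.induce_compl_singleton_of_degree_eq_one hv
      have hcard' : Fintype.card ({v}ᶜ : Set W) = n := by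
        rw [Fintype.card_compl_set, hW]; simp
      have huni' : (G.induce {v}ᶜ).edgeFinset.card = n := by
        rw [SimpleGraph.card_edgeFinset_induce_compl_singleton,
          SimpleGraph.card_edgeFinset_deleteIncidenceSet, huni, hv]; rfl
      have hstep := card_farPairs_leaf_le G hvw
      rw [hW] at hstep
      have hwlt : G.degree w < n + 1 := hW ▸ G.degree_lt_card_verts w
      have hwdom : G.degree w = n → ∀ x, x ≠ w → G.Adj w x := by
        intro h x hx
        have h1 : insert w (G.neighborFinset w) = univ := by
          rw [← card_eq_iff_eq_univ, card_insert_of_notMem (by simp),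
            SimpleGraph.card_neighborFinset_eq_degree, h, hW]
        have h2 := mem_univ x
        rw [← h1] at h2
        simpa [hx] using h2
      by_cases hwn : G.degree w = n
      · exact Or.inl ⟨w, hwdom hwn⟩
      rcases ih _ (G.induce {v}ᶜ) hcard' hconn' huni' with ⟨c, hc⟩ | ⟨h5, h2⟩ | h
      · obtain ⟨a, b, -, -, -, hadj⟩ :=
          exists_adj_iff_of_dominating (G.induce {v}ᶜ) (huni'.trans hcard'.symm) hc
        by_cases hwc : w = c
        · left
          refine ⟨w, fun x hx => ?_⟩
          by_cases hxv : x = v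
          · subst hxv; exact ((hvw w).mpr rfl).symm
          · subst hwc
            exact hc ⟨x, hxv⟩ fun h => hx (congrArg Subtype.val h)
        · right; right
          have hsub : G.neighborFinset w ⊆
              {v, (c : W), if w = a then (b : W) else (a : W)} := by
            intro x hx
            rw [SimpleGraph.mem_neighborFinset] at hx
            by_cases hxv : x = v
            · simp [hxv]
            · have hwv : w ≠ v := ((hvw w).mpr rfl).ne'
              have h := (hadj ⟨w, hwv⟩ ⟨x, hxv⟩).mp hx
              simp only [Subtype.ext_iff] at h
              simp only [mem_insert, mem_singleton]
              grind
          have h3 := (card_le_card hsub).trans card_le_three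
          rw [SimpleGraph.card_neighborFinset_eq_degree] at h3
          omega
      · right; right
        have hwv : w ≠ v := ((hvw w).mpr rfl).ne'
        have h3 : G.degree w ≤ 3 := by
          have hsub : G.neighborFinset w ⊆ insert v
              (((G.induce {v}ᶜ).neighborFinset ⟨w, hwv⟩).image Subtype.val) := by
            intro x hx
            rw [SimpleGraph.mem_neighborFinset] at hx
            by_cases hxv : x = v
            · simp [hxv]
            · refine mem_insert_of_mem (mem_image.mpr ⟨⟨x, hxv⟩, ?_, rfl⟩)
              simpa using hx
          have h4 := (card_le_card hsub).trans (card_insert_le _ _)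
          have h5 := card_image_le (s := (G.induce {v}ᶜ).neighborFinset ⟨w, hwv⟩)
            (f := Subtype.val)
          rw [SimpleGraph.card_neighborFinset_eq_degree] at h4 h5
          rw [h2] at h5
          omega
        omega
      · right; right
        omega
    · have hge : ∀ x ∈ univ, 2 ≤ G.degree x := fun x _ => by
        have h1 := hpos x
        have h2 : G.degree x ≠ 1 := fun h => hleaf ⟨x, h⟩
        omega
      have hall : ∀ x, G.degree x = 2 := by
        have h : ∑ x : W, 2 = ∑ x, G.degree x := by
          rw [hsum, huni]; simp [hW, mul_comm]
        exact fun x => ((sum_eq_sum_iff_of_le hge).mp h x (mem_univ x)).symm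
      right
      by_cases h5 : n + 1 = 5
      · exact Or.inl ⟨h5, hall⟩
      · right
        have h := card_farPairs_of_two_regular G hall
        rw [hW] at h
        nlinarith [show 6 ≤ n + 1 by omega]

end Combinatorics

section Distances

lemma le_sum_dist (G : SimpleGraph V) [DecidableRel G.Adj] (hconn : G.Connected)
    (huni : G.edgeFinset.card = Fintype.card V) :
    2 * (Fintype.card V : ℝ) ^ 2 - 4 * Fintype.card V + (farPairs G).card ≤
      ∑ u, ∑ v, (G.dist u v : ℝ) := by
  have key : ∀ u v, (2 : ℝ) - (if u = v then 2 else 0) - (if G.Adj u v then 1 else 0) +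
      (if (u, v) ∈ farPairs G then 1 else 0) ≤ G.dist u v := by
    intro u v
    by_cases huv : u = v
    · subst huv; simp [mem_farPairs]
    have h0 : G.dist u v ≠ 0 := fun h => huv (hconn.dist_eq_zero_iff.mp h)
    by_cases hadj : G.Adj u v
    · have h1 := SimpleGraph.dist_eq_one_iff_adj.mpr hadj
      simp [huv, hadj, h1, mem_farPairs]
      norm_num
    have h1 : G.dist u v ≠ 1 := fun h => hadj (SimpleGraph.dist_eq_one_iff_adj.mp h)
    by_cases hfar : (u, v) ∈ farPairs G
    · have h2 : G.dist u v ≠ 2 := by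
        intro h
        have he : G.edist u v = 2 := by
          rw [← (hconn u v).coe_dist_eq_edist, h]; rfl
        obtain ⟨-, -, w, hw⟩ := SimpleGraph.edist_eq_two_iff.mp he
        rw [SimpleGraph.mem_commonNeighbors] at hw
        exact (mem_farPairs.mp hfar).2.2 w ⟨hw.1, hw.2.symm⟩
      have h3 : (3 : ℝ) ≤ G.dist u v := by exact_mod_cast (by omega : 3 ≤ G.dist u v)
      simp only [huv, hadj, hfar, if_true, if_false]
      linarith
    · have h3 : (2 : ℝ) ≤ G.dist u v := by exact_mod_cast (by omega : 2 ≤ G.dist u v)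
      simp only [huv, hadj, hfar, if_false]
      linarith
  have hle := sum_le_sum fun u (_ : u ∈ univ) => sum_le_sum fun v (_ : v ∈ univ) => key u v
  refine le_trans (le_of_eq ?_) hle
  simp only [sum_add_distrib, sum_sub_distrib]
  have h1 : ∑ u, ∑ v, (if G.Adj u v then (1 : ℝ) else 0) = 2 * Fintype.card V := by
    have h := G.sum_degrees_eq_twice_card_edges
    rw [huni] at h
    rw [← Nat.cast_ofNat, ← Nat.cast_mul, ← h]
    push_cast
    refine sum_congr rfl fun u _ => ?_
    rw [sum_boole, ← SimpleGraph.card_neighborFinset_eq_degree,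
      SimpleGraph.neighborFinset_eq_filter]
  have h2 : ∑ u, ∑ v, (if (u, v) ∈ farPairs G then (1 : ℝ) else 0) = (farPairs G).card := by
    rw [← Fintype.sum_prod_type' (f := fun u v => if (u, v) ∈ farPairs G then (1 : ℝ) else 0)]
    simp
  rw [h1, h2]
  simp
  ring

lemma dist_le_of_iso {X Y : Type*} {G : SimpleGraph X} {H : SimpleGraph Y} (e : G ≃g H) {u v : X}
    (h : G.Reachable u v) : H.dist (e u) (e v) ≤ G.dist u v := by
  obtain ⟨p, hp⟩ := h.exists_walk_length_eq_dist
  rw [← hp, ← SimpleGraph.Walk.length_map e.toHom p]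
  exact SimpleGraph.dist_le _

lemma dist_congr_iso {X Y : Type*} {G : SimpleGraph X} {H : SimpleGraph Y} (e : G ≃g H) (u v : X) :
    H.dist (e u) (e v) = G.dist u v := by
  by_cases h : G.Reachable u v
  · refine le_antisymm (dist_le_of_iso e h) ?_
    simpa using dist_le_of_iso e.symm (e.reachable_iff.mpr h)
  · rw [SimpleGraph.dist_eq_zero_of_not_reachable h,
      SimpleGraph.dist_eq_zero_of_not_reachable (mt e.reachable_iff.mp h)]

end Distances

section Spectrum

lemma lt_of_mem_spectrum_of_mulVec_lt (A : Matrix V V ℝ) (hA : ∀ i j, 0 ≤ A i j) (y : V → ℝ)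
    (hy : ∀ i, 0 < y i) (c : ℝ) (hAy : ∀ i, (A *ᵥ y) i < c * y i) {l : ℝ}
    (hl : l ∈ spectrum ℝ A) : l < c := by
  rw [← Matrix.spectrum_toLin', ← Module.End.hasEigenvalue_iff_mem_spectrum] at hl
  obtain ⟨x, hx⟩ := hl.exists_hasEigenvector
  have hxne : x ≠ 0 := hx.2
  have hAx : A *ᵥ x = l • x := by simpa using hx.apply_eq_smul
  obtain ⟨j, hj⟩ := Function.ne_iff.mp hxne
  obtain ⟨i, -, hi⟩ := exists_max_image univ (fun i => |x i| / y i) ⟨j, mem_univ j⟩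
  set M := |x i| / y i with hM
  have hMpos : 0 < M := lt_of_lt_of_le (div_pos (abs_pos.mpr hj) (hy j)) (hi j (mem_univ j))
  have hbound : ∀ k, |x k| ≤ M * y k := fun k => (div_le_iff₀ (hy k)).mp (hi k (mem_univ k))
  have hxi : |x i| = M * y i := by rw [hM, div_mul_cancel₀ _ (hy i).ne']
  have h1 : l * |x i| < c * |x i| := calc
    l * |x i| ≤ |l * x i| := by rw [abs_mul]; gcongr; exact le_abs_self l
    _ = |(A *ᵥ x) i| := by rw [hAx]; simp
    _ ≤ ∑ k, |A i k * x k| := abs_sum_le_sum_abs _ _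
    _ ≤ ∑ k, M * (A i k * y k) := sum_le_sum fun k _ => by
      rw [abs_mul, abs_of_nonneg (hA i k)]
      nlinarith [mul_le_mul_of_nonneg_left (hbound k) (hA i k)]
    _ = M * (A *ᵥ y) i := by rw [← mul_sum]; rfl
    _ < M * (c * y i) := by gcongr; exact hAy i
    _ = c * |x i| := by rw [hxi]; ring
  exact lt_of_mul_lt_mul_right h1 (abs_nonneg _)

lemma exists_mem_spectrum_ge [Nonempty V] (A : Matrix V V ℝ) (hA : A.IsHermitian) (c : ℝ)
    (hc : c * Fintype.card V ≤ ∑ i, ∑ j, A i j) : ∃ l ∈ spectrum ℝ A, c ≤ l := by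
  have hB : (algebraMap ℝ (Matrix V V ℝ) c - A).IsHermitian := by
    refine Matrix.IsHermitian.sub ?_ hA
    rw [Matrix.algebraMap_eq_diagonal]
    exact Matrix.isHermitian_diagonal _
  by_contra! hcon
  have hpd : (algebraMap ℝ (Matrix V V ℝ) c - A).PosDef := by
    rw [hB.posDef_iff_eigenvalues_pos]
    intro i
    have hmem := hB.eigenvalues_mem_spectrum_real i
    rw [← spectrum.singleton_sub_eq] at hmem
    obtain ⟨_, rfl, l, hl, h⟩ := Set.mem_sub.mp hmem
    rw [← h]
    exact sub_pos.mpr (hcon l hl)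
  have h := hpd.dotProduct_mulVec_pos (x := fun _ => 1) (by
    obtain ⟨v⟩ := ‹Nonempty V›
    exact fun h => one_ne_zero (congrFun h v))
  have h2 : (star fun _ : V => (1 : ℝ)) ⬝ᵥ
      ((algebraMap ℝ (Matrix V V ℝ) c - A) *ᵥ fun _ => 1) =
        c * Fintype.card V - ∑ i, ∑ j, A i j := by
    simp [Matrix.algebraMap_eq_diagonal, dotProduct, mulVec, Matrix.diagonal_apply, mul_comm]
  linarith

lemma isHermitian_Dalpha (G : SimpleGraph V) (α : ℝ) : (Dalpha G α).IsHermitian := by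
  ext i j
  by_cases h : i = j
  · subst h; simp
  · simp [Dalpha, distMatrix, h, Ne.symm h, G.dist_comm]

lemma sum_Dalpha (G : SimpleGraph V) (α : ℝ) :
    ∑ i, ∑ j, Dalpha G α i j = ∑ i, ∑ j, (G.dist i j : ℝ) := by
  refine sum_congr rfl fun i _ => ?_
  simp [Dalpha, distMatrix, Matrix.diagonal_apply, sum_add_distrib, ← mul_sum, transmission]
  ring

lemma le_muAlpha [Nonempty V] (G : SimpleGraph V) (α c : ℝ)
    (hc : c * Fintype.card V ≤ ∑ i, ∑ j, (G.dist i j : ℝ)) : c ≤ muAlpha G α := by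
  obtain ⟨l, hl, hcl⟩ := exists_mem_spectrum_ge (Dalpha G α) (isHermitian_Dalpha G α) c
    (by rwa [sum_Dalpha])
  exact hcl.trans (le_csSup (Matrix.finite_real_spectrum (A := Dalpha G α)).bddAbove hl)

lemma muAlpha_mem_spectrum [Nonempty V] (G : SimpleGraph V) (α : ℝ) :
    muAlpha G α ∈ spectrum ℝ (Dalpha G α) := by
  obtain ⟨v⟩ := ‹Nonempty V›
  exact Set.Nonempty.csSup_mem ⟨_, (isHermitian_Dalpha G α).eigenvalues_mem_spectrum_real v⟩
    Matrix.finite_real_spectrum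

lemma muAlpha_congr_iso {W : Type*} [Fintype W] [DecidableEq W] {G : SimpleGraph V}
    {H : SimpleGraph W} (e : G ≃g H) (α : ℝ) : muAlpha G α = muAlpha H α := by
  have h : Matrix.reindexAlgEquiv ℝ ℝ e.toEquiv.symm (Dalpha H α) = Dalpha G α := by
    ext i j
    have ht : transmission H (e i) = transmission G i := by
      unfold transmission
      rw [← e.toEquiv.sum_comp]
      exact sum_congr rfl fun v _ => by
        exact congrArg Nat.cast (dist_congr_iso e i v)
    by_cases hij : i = j
    · subst hij; simp [Dalpha, distMatrix, ht]
    · simp [Dalpha, distMatrix, hij, dist_congr_iso e i j]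
  rw [muAlpha, muAlpha, ← h, AlgEquiv.spectrum_eq]

end Spectrum

section SnPlus

lemma SnPlus_adj {n : ℕ} (x y : Fin n) : (SnPlus n).Adj x y ↔ x ≠ y ∧ (x.val = 0 ∨ y.val = 0 ∨
    (x.val = 1 ∧ y.val = 2) ∨ (x.val = 2 ∧ y.val = 1)) := by
  simp only [SnPlus, SimpleGraph.fromRel_adj]
  tauto

lemma nonempty_iso_SnPlus {n : ℕ} (hn : 3 ≤ n) {W : Type*} [Fintype W] (G : SimpleGraph W)
    (hcard : Fintype.card W = n) {a b c : W} (hac : a ≠ c) (hbc : b ≠ c) (hab : a ≠ b)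
    (hadj : ∀ x y, G.Adj x y ↔
      x ≠ y ∧ (x = c ∨ y = c ∨ (x = a ∧ y = b) ∨ (x = b ∧ y = a))) :
    Nonempty (G ≃g SnPlus n) := by
  let z : Fin n := ⟨0, by omega⟩
  let o : Fin n := ⟨1, by omega⟩
  let t : Fin n := ⟨2, by omega⟩
  obtain ⟨e, hc, ha, hb⟩ : ∃ e : W ≃ Fin n, e c = z ∧ e a = o ∧ e b = t := by
    let e₀ : W ≃ Fin n := Fintype.equivFinOfCardEq hcard
    let e₁ := e₀.trans (Equiv.swap (e₀ c) z)
    let e₂ := e₁.trans (Equiv.swap (e₁ a) o)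
    have h1 : e₁ c = z := by simp [e₁]
    have hzo : z ≠ o := by simp [z, o]
    have hzt : z ≠ t := by simp [z, t]
    have hot : o ≠ t := by simp [o, t]
    have h2a : e₂ a = o := by simp [e₂]
    have h2c : e₂ c = z := by
      have : z ≠ e₁ a := fun h => hac (e₁.injective (h ▸ h1.symm ▸ rfl))
      simp only [e₂, Equiv.trans_apply, h1]
      exact Equiv.swap_apply_of_ne_of_ne this hzo
    refine ⟨e₂.trans (Equiv.swap (e₂ b) t), ?_, ?_, by simp⟩
    · rw [Equiv.trans_apply, h2c]
      exact Equiv.swap_apply_of_ne_of_ne (fun h => hbc (e₂.injective (h.symm.trans h2c.symm))) hzt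
    · rw [Equiv.trans_apply, h2a]
      exact Equiv.swap_apply_of_ne_of_ne (fun h => hab (e₂.injective (h2a.trans h))) hot
  have hz : ∀ x, (e x).val = 0 ↔ x = c := fun x => by
    rw [← e.injective.eq_iff, hc, Fin.ext_iff]
  have ho : ∀ x, (e x).val = 1 ↔ x = a := fun x => by
    rw [← e.injective.eq_iff, ha, Fin.ext_iff]
  have ht : ∀ x, (e x).val = 2 ↔ x = b := fun x => by
    rw [← e.injective.eq_iff, hb, Fin.ext_iff]
  refine ⟨⟨e, fun {x y} => ?_⟩⟩
  rw [SnPlus_adj, hadj, hz, hz, ho, ho, ht, ht, e.injective.ne_iff]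

lemma muAlpha_SnPlus_lt {n : ℕ} (hn : 8 ≤ n) {α : ℝ} (hα0 : 0 ≤ α) (hα1 : α < 1) :
    muAlpha (SnPlus n) α < 2 * n - 3 := by
  have hn' : (8 : ℝ) ≤ n := by exact_mod_cast hn
  let z : Fin n := ⟨0, by omega⟩
  have : Nonempty (Fin n) := ⟨z⟩
  have hz : ∀ x, x ≠ z → (SnPlus n).Adj z x := fun x hx =>
    (SnPlus_adj z x).mpr ⟨hx.symm, Or.inl rfl⟩
  have hd1 : ∀ x, x ≠ z → (SnPlus n).dist z x = 1 := fun x hx =>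
    SimpleGraph.dist_eq_one_iff_adj.mpr (hz x hx)
  have hd1' : ∀ x, x ≠ z → (SnPlus n).dist x z = 1 := fun x hx =>
    (SimpleGraph.dist_comm ..).trans (hd1 x hx)
  have hd2 : ∀ x y, x ≠ z → y ≠ z → (SnPlus n).dist x y ≤ 2 := fun x y hx hy =>
    SimpleGraph.dist_le (.cons (hz x hx).symm (.cons (hz y hy) .nil))
  have hTz : transmission (SnPlus n) z = n - 1 := by
    have h : ∀ x, ((SnPlus n).dist z x : ℝ) = 1 - if x = z then 1 else 0 := fun x => by
      by_cases hx : x = z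
      · simp [hx]
      · simp [hx, hd1 x hx]
    simp [transmission, h]
  have hT : ∀ x, x ≠ z → transmission (SnPlus n) x ≤ 2 * n - 3 := by
    intro x hx
    have h : ∀ y, ((SnPlus n).dist x y : ℝ) ≤
        2 - (if y = z then 1 else 0) - (if y = x then 2 else 0) := fun y => by
      by_cases hyx : y = x
      · subst hyx; simp [hx]
      by_cases hyz : y = z
      · subst hyz; simp [hyx, hd1' x hx]; norm_num
      · simp only [hyx, hyz, if_false, sub_zero]
        exact_mod_cast hd2 x y hx hyz
    refine (sum_le_sum fun y _ => h y).trans (le_of_eq ?_)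
    simp only [sum_sub_distrib]
    simp
    ring
  have hD0 : ∀ (x y : Fin n), (0 : ℝ) ≤ (SnPlus n).dist x y := fun _ _ => Nat.cast_nonneg _
  have hmul : ∀ (y : Fin n → ℝ) i, (Dalpha (SnPlus n) α *ᵥ y) i =
      α * (transmission (SnPlus n) i * y i) + (1 - α) * ∑ j, (SnPlus n).dist i j * y j := by
    intro y i
    rw [Dalpha, Matrix.add_mulVec, Matrix.smul_mulVec, Matrix.smul_mulVec, Pi.add_apply,
      Pi.smul_apply, Pi.smul_apply, Matrix.mulVec_diagonal]
    rfl
  refine lt_of_mem_spectrum_of_mulVec_lt (Dalpha (SnPlus n) α) ?_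
    (fun i => 1 - if i = z then 1 / 4 else 0) ?_ _ ?_ (muAlpha_mem_spectrum _ α)
  · intro i j
    have h1 : 0 ≤ (1 - α) * ((SnPlus n).dist i j : ℝ) :=
      mul_nonneg (by linarith) (hD0 i j)
    by_cases hij : i = j
    · subst hij
      have h2 : 0 ≤ α * transmission (SnPlus n) i := mul_nonneg hα0 (sum_nonneg fun j _ => hD0 i j)
      simpa [Dalpha, distMatrix] using h2
    · simpa [Dalpha, distMatrix, hij] using h1
  · intro i
    split_ifs <;> norm_num
  · intro i
    rw [hmul]
    have hs : ∑ j, ((SnPlus n).dist i j : ℝ) * (1 - if j = z then 1 / 4 else 0) =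
        transmission (SnPlus n) i - (SnPlus n).dist i z / 4 := by
      simp [mul_sub, transmission]
      ring
    rw [hs]
    by_cases hi : i = z
    · subst hi
      simp only [if_true, hTz, SimpleGraph.dist_self]
      push_cast
      nlinarith
    · simp only [hi, if_false, hd1' i hi]
      have := hT i hi
      push_cast
      nlinarith

end SnPlus

/-- `Sₙ⁺` uniquely minimizes the distance α-spectral radius among unicyclic
graphs on `n ≥ 8` vertices. -/
theorem unicyclic_muAlpha_ge (n : ℕ) (hn : 8 ≤ n) (G : SimpleGraph V)
    [DecidableRel G.Adj] (hcard : Fintype.card V = n) (hconn : G.Connected)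
    (huni : G.edgeFinset.card = n) (α : ℝ) (hα0 : 0 ≤ α) (hα1 : α < 1) :
    muAlpha G α ≥ muAlpha (SnPlus n) α ∧
      (muAlpha G α = muAlpha (SnPlus n) α ↔ Nonempty (G ≃g SnPlus n)) := by
  have hn' : (8 : ℝ) ≤ n := by exact_mod_cast hn
  have hne : Nonempty V := hconn.nonempty
  by_cases hdom : ∃ c, ∀ x, x ≠ c → G.Adj c x
  · obtain ⟨c, hc⟩ := hdom
    obtain ⟨a, b, hac, hbc, hab, hadj⟩ :=
      exists_adj_iff_of_dominating G (huni.trans hcard.symm) hc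
    obtain ⟨e⟩ := nonempty_iso_SnPlus (by omega) G hcard hac hbc hab hadj
    have h := muAlpha_congr_iso e α
    exact ⟨h.ge, fun _ => ⟨e⟩, fun _ => h⟩
  · have hfar : 2 * n ≤ (farPairs G).card + 8 := by
      rcases dominating_or_card_farPairs n V G hcard hconn huni with h | ⟨h, -⟩ | h
      · exact absurd h hdom
      · omega
      · exact h
    have hfar' : (2 * n : ℝ) ≤ (farPairs G).card + 8 := by exact_mod_cast hfar
    have hsum := le_sum_dist G hconn (huni.trans hcard.symm)
    have hge : (2 * n - 3 : ℝ) ≤ muAlpha G α := by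
      refine le_muAlpha G α _ (le_trans ?_ hsum)
      rw [hcard]
      nlinarith
    have hlt := (muAlpha_SnPlus_lt hn hα0 hα1).trans_le hge
    exact ⟨hlt.le, fun h => absurd h hlt.ne', fun ⟨e⟩ => muAlpha_congr_iso e α⟩

end DistAlpha
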